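/- Let {I_j} be a sequence of arcs in ∂𝔻 with Σ_j |I_j| < ∞. Then there exists a positive function f ∈ VMO such that the averages (1/m(I_j))∫_{I_j} f dm tend to +∞ as j → ∞. -/

import Mathlib

open MeasureTheory Filter Set Topology

noncomputable section

/-- The open unit disc in `ℂ`. -/
def unitDisc : Set ℂ := {z : ℂ | ‖z‖ < 1}

/-- The point `e^{iθ}` on the unit circle. -/
def circlePt (θ : ℝ) : ℂ := Complex.exp ((θ : ℂ) * Complex.I)

/-- The Carleson square based on the arc centered at `e^{iθ₀}` of normalized length `t`. -/
def carlesonSquare (θ₀ t : ℝ) : Set ℂ :=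
  {z : ℂ | z ∈ unitDisc ∧ 1 - t ≤ ‖z‖ ∧
    ∃ θ : ℝ, |θ - θ₀| ≤ Real.pi * t ∧ z = (‖z‖ : ℂ) * circlePt θ}

/-- `μ` is a Carleson measure. -/
def IsCarleson (μ : Measure ℂ) : Prop :=
  ∃ C : ℝ, 0 < C ∧ ∀ θ₀ t : ℝ, 0 < t → t ≤ 1 →
    μ (carlesonSquare θ₀ t) ≤ ENNReal.ofReal (C * t)

/-- `μ` is a vanishing Carleson measure. -/
def IsVanishingCarleson (μ : Measure ℂ) : Prop :=
  IsCarleson μ ∧ ∀ ε : ℝ, 0 < ε → ∃ δ : ℝ, 0 < δ ∧ ∀ θ₀ t : ℝ, 0 < t → t < δ →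
    μ (carlesonSquare θ₀ t) ≤ ENNReal.ofReal (ε * t)

/-- The measure `|E| μ`, i.e. `d(|E|μ)(z) = |E(z)| dμ(z)`. -/
def absDensity (E : ℂ → ℂ) (μ : Measure ℂ) : Measure ℂ :=
  μ.withDensity (fun z => ENNReal.ofReal ‖E z‖)

/-- Average of a boundary function (in the angle variable) over the arc
centered at `e^{iθ₀}` of normalized length `t`; `dm = dθ/(2π)`. -/
def arcAvg (f : ℝ → ℂ) (θ₀ t : ℝ) : ℂ :=
  ((2 * Real.pi * t)⁻¹ : ℝ) •
    ∫ θ in Set.Ioo (θ₀ - Real.pi * t) (θ₀ + Real.pi * t), f θ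

/-- Mean oscillation of a boundary function over the arc centered at `e^{iθ₀}`
of normalized length `t`. -/
def meanOsc (f : ℝ → ℂ) (θ₀ t : ℝ) : ℝ :=
  (2 * Real.pi * t)⁻¹ *
    ∫ θ in Set.Ioo (θ₀ - Real.pi * t) (θ₀ + Real.pi * t), ‖f θ - arcAvg f θ₀ t‖

/-- A (2π-periodic, integrable) boundary function has bounded mean oscillation. -/
def IsBMO (f : ℝ → ℂ) : Prop :=
  (∀ θ : ℝ, f (θ + 2 * Real.pi) = f θ) ∧
  IntegrableOn f (Set.Ioc 0 (2 * Real.pi)) ∧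
  ∃ C : ℝ, ∀ θ₀ t : ℝ, 0 < t → t ≤ 1 → meanOsc f θ₀ t ≤ C

/-- A boundary function has vanishing mean oscillation. -/
def IsVMO (f : ℝ → ℂ) : Prop :=
  IsBMO f ∧ ∀ ε : ℝ, 0 < ε → ∃ δ : ℝ, 0 < δ ∧
    ∀ θ₀ t : ℝ, 0 < t → t < δ → meanOsc f θ₀ t ≤ ε

/-- The BMO seminorm of a boundary function. -/
def bmoSeminorm (f : ℝ → ℂ) : ℝ :=
  sSup {c : ℝ | ∃ θ₀ t : ℝ, 0 < t ∧ t ≤ 1 ∧ c = meanOsc f θ₀ t}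

/-- `Fb` is the (a.e.) radial boundary function of `F`. -/
def HasRadialLimits (F : ℂ → ℂ) (Fb : ℝ → ℂ) : Prop :=
  ∀ᵐ θ ∂(volume.restrict (Set.Ioc 0 (2 * Real.pi))),
    Tendsto (fun r : ℝ => F ((r : ℂ) * circlePt θ))
      (nhdsWithin 1 (Set.Iio 1)) (nhds (Fb θ))

/-- `F` is a bounded analytic function on the unit disc. -/
def MemHinf (F : ℂ → ℂ) : Prop :=
  DifferentiableOn ℂ F unitDisc ∧ ∃ M : ℝ, ∀ z ∈ unitDisc, ‖F z‖ ≤ M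

/-- `F` belongs to `QA` with boundary function `Fb`: it is a bounded analytic
function on the disc whose radial boundary values are in VMO. -/
def MemQA (F : ℂ → ℂ) (Fb : ℝ → ℂ) : Prop :=
  MemHinf F ∧ HasRadialLimits F Fb ∧ IsVMO Fb

/-- `E` is an outer function. -/
def IsOuter (E : ℂ → ℂ) : Prop :=
  DifferentiableOn ℂ E unitDisc ∧
  ∃ h : ℝ → ℝ, IntegrableOn h (Set.Ioc 0 (2 * Real.pi)) ∧ ∀ z ∈ unitDisc,
    E z = Complex.exp (((2 * Real.pi)⁻¹ : ℝ) • ∫ θ in Set.Ioc 0 (2 * Real.pi),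
      ((circlePt θ + z) / (circlePt θ - z)) * (h θ : ℂ))

/-- The integral means appearing in the definition of the Hardy space `ℍ^p`. -/
def hardyIntegral (p : ℝ) (F : ℂ → ℂ) (r : ℝ) : ℝ :=
  ∫ θ in Set.Ioc 0 (2 * Real.pi), ‖F ((r : ℂ) * circlePt θ)‖ ^ p

/-- `F` belongs to the Hardy space `ℍ^p`, `0 < p < ∞`. -/
def MemHardy (p : ℝ) (F : ℂ → ℂ) : Prop :=
  DifferentiableOn ℂ F unitDisc ∧
  ∃ M : ℝ, ∀ r : ℝ, 0 < r → r < 1 → hardyIntegral p F r ≤ M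

/-- `F` belongs to `BMOA` with boundary function `Fb`. -/
def MemBMOA (F : ℂ → ℂ) (Fb : ℝ → ℂ) : Prop :=
  MemHardy 2 F ∧ HasRadialLimits F Fb ∧ IsBMO Fb

/-- `F` belongs to `VMOA` with boundary function `Fb`. -/
def MemVMOA (F : ℂ → ℂ) (Fb : ℝ → ℂ) : Prop :=
  MemHardy 2 F ∧ HasRadialLimits F Fb ∧ IsVMO Fb

/-- The generalized Volterra operator `T_G(F)(z) = ∫₀^z F(w) G'(w) dw`. -/
def volterra (G F : ℂ → ℂ) (z : ℂ) : ℂ :=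
  ∫ t in (0:ℝ)..1, z * F ((t : ℂ) * z) * deriv G ((t : ℂ) * z)

lemma norm_circlePt (θ : ℝ) : ‖circlePt θ‖ = 1 :=
  Complex.norm_exp_ofReal_mul_I θ

lemma circleMap_zero_one_eq_circlePt (θ : ℝ) : circleMap 0 1 θ = circlePt θ := by
  simp [circleMap, circlePt]

lemma circlePt_add_two_pi (θ : ℝ) : circlePt (θ + 2 * Real.pi) = circlePt θ := by
  simp only [← circleMap_zero_one_eq_circlePt]
  exact periodic_circleMap 0 1 θ

lemma norm_circlePt_sub_le (a b : ℝ) : ‖circlePt a - circlePt b‖ ≤ |a - b| := by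
  have h : circlePt a - circlePt b =
      circlePt b * (Complex.exp (Complex.I * ((a - b : ℝ) : ℂ)) - 1) := by
    rw [mul_sub, circlePt, circlePt, ← Complex.exp_add]
    push_cast
    ring_nf
  rw [h, norm_mul, norm_circlePt, one_mul]
  exact Real.norm_exp_I_mul_ofReal_sub_one_le

lemma uniformContinuous_circlePt : UniformContinuous circlePt :=
  (LipschitzWith.of_dist_le_mul (K := 1) fun a b => by
    simpa [dist_eq_norm] using norm_circlePt_sub_le a b).uniformContinuous

/-- The point at distance `t` from the boundary on the radius through `e^{iθ₀}`. -/
def discPt (θ₀ t : ℝ) : ℂ := ((1 - t : ℝ) : ℂ) * circlePt θ₀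

lemma norm_discPt {θ₀ t : ℝ} (ht1 : t ≤ 1) : ‖discPt θ₀ t‖ = 1 - t := by
  rw [discPt, norm_mul, norm_circlePt, mul_one, Complex.norm_real, Real.norm_of_nonneg (by linarith)]

lemma sq_norm_circlePt_sub_discPt_le {θ₀ t θ : ℝ} (ht : 0 < t) (hθ : |θ - θ₀| ≤ Real.pi * t) :
    ‖circlePt θ - discPt θ₀ t‖ ^ 2 ≤ 25 * t ^ 2 := by
  have h : circlePt θ - discPt θ₀ t = (circlePt θ - circlePt θ₀) + (t : ℂ) * circlePt θ₀ := by
    rw [discPt]; push_cast; ring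
  have h1 : ‖circlePt θ - discPt θ₀ t‖ ≤ 5 * t := by
    rw [h]
    refine (norm_add_le _ _).trans ?_
    rw [norm_mul, norm_circlePt, mul_one, Complex.norm_real, Real.norm_of_nonneg ht.le]
    have := norm_circlePt_sub_le θ θ₀
    nlinarith [Real.pi_le_four]
  nlinarith [norm_nonneg (circlePt θ - discPt θ₀ t)]

lemma circlePt_ne_discPt {θ₀ t θ : ℝ} (ht : 0 < t) (ht1 : t ≤ 1) :
    circlePt θ ≠ discPt θ₀ t := by
  intro h
  have := congrArg norm h
  rw [norm_circlePt, norm_discPt ht1] at this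
  linarith

/-- The Poisson kernel of `discPt θ₀ t` at the boundary point `e^{iθ}`. -/
def poissonAt (θ₀ t θ : ℝ) : ℝ := poissonKernel 0 (discPt θ₀ t) (circlePt θ)

lemma poissonAt_eq {θ₀ t θ : ℝ} (ht1 : t ≤ 1) :
    poissonAt θ₀ t θ = (1 - (1 - t) ^ 2) / ‖circlePt θ - discPt θ₀ t‖ ^ 2 := by
  rw [poissonAt, poissonKernel_def, sub_zero, sub_zero, norm_circlePt, norm_discPt ht1, one_pow]

lemma poissonAt_nonneg {θ₀ t θ : ℝ} (ht : 0 < t) (ht1 : t ≤ 1) : 0 ≤ poissonAt θ₀ t θ := by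
  rw [poissonAt_eq ht1]
  exact div_nonneg (by nlinarith) (sq_nonneg _)

lemma one_le_mul_poissonAt {θ₀ t θ : ℝ} (ht : 0 < t) (ht1 : t ≤ 1)
    (hθ : |θ - θ₀| ≤ Real.pi * t) : 1 ≤ 25 * t * poissonAt θ₀ t θ := by
  have hpos : 0 < ‖circlePt θ - discPt θ₀ t‖ :=
    norm_pos_iff.2 (sub_ne_zero.2 (circlePt_ne_discPt ht ht1))
  have h := sq_norm_circlePt_sub_discPt_le ht hθ
  rw [poissonAt_eq ht1, ← mul_div_assoc, le_div_iff₀ (by positivity)]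
  nlinarith [mul_pos ht ht]

lemma continuous_poissonAt {θ₀ t : ℝ} (ht : 0 < t) (ht1 : t ≤ 1) :
    Continuous (poissonAt θ₀ t) := by
  simp only [funext fun θ => poissonAt_eq (θ₀ := θ₀) (θ := θ) ht1]
  refine Continuous.div₀ (by fun_prop)
    (((uniformContinuous_circlePt.continuous.sub continuous_const).norm).pow 2) fun θ => ?_
  exact pow_ne_zero 2 (norm_ne_zero_iff.2 (sub_ne_zero.2 (circlePt_ne_discPt ht ht1)))

lemma continuous_comp_circlePt {E : Type*} [TopologicalSpace E] {f : ℂ → E}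
    (hf : ContinuousOn f (Metric.closedBall 0 1)) : Continuous fun θ => f (circlePt θ) :=
  hf.comp_continuous uniformContinuous_circlePt.continuous fun θ => by simp [norm_circlePt]

/-- Poisson formula for the real part of an analytic function, in the angle variable. -/
lemma integral_poissonAt_mul_re {f : ℂ → ℂ} (hf : DiffContOnCl ℂ f (Metric.ball 0 1))
    {θ₀ t : ℝ} (ht : 0 < t) (ht1 : t ≤ 1) :
    ∫ θ in (0 : ℝ)..2 * Real.pi, poissonAt θ₀ t θ * (f (circlePt θ)).re
      = 2 * Real.pi * (f (discPt θ₀ t)).re := by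
  have hw : discPt θ₀ t ∈ Metric.ball (0 : ℂ) 1 := by
    rw [mem_ball_zero_iff, norm_discPt ht1]; linarith
  have h := hf.circleAverage_poissonKernel_smul hw
  rw [Real.circleAverage_def] at h
  have hfc : ContinuousOn f (Metric.closedBall 0 1) := hf.continuousOn_ball
  have h2 : (∫ θ in (0 : ℝ)..2 * Real.pi,
      (poissonAt θ₀ t θ : ℂ) * f (circlePt θ)) = (2 * Real.pi : ℝ) * f (discPt θ₀ t) := by
    rw [← h, Complex.real_smul, ← mul_assoc, ← Complex.ofReal_mul,
      mul_inv_cancel₀ (by positivity), Complex.ofReal_one, one_mul]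
    refine intervalIntegral.integral_congr fun θ _ => ?_
    simp [circleMap_zero_one_eq_circlePt, poissonAt]
  have h3 := congrArg Complex.re h2
  rw [Complex.re_ofReal_mul] at h3
  rw [← h3, ← Complex.reCLM_apply, ← ContinuousLinearMap.intervalIntegral_comp_comm]
  · simp
  · exact ((Complex.continuous_ofReal.comp (continuous_poissonAt ht ht1)).mul
      (continuous_comp_circlePt hfc)).intervalIntegrable _ _

/-- The absolute constant bounding the mean oscillation of conjugates of bounded functions. -/
def oscConst : ℝ := (1 + 25 * Real.pi ^ 2) / 2

/-- The real part of an analytic function with bounded imaginary part has bounded mean oscillation,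
with the value at `discPt θ₀ t` in place of the average. -/
lemma integral_abs_re_sub_le {G : ℂ → ℂ} (hG : DiffContOnCl ℂ G (Metric.ball 0 1))
    (him : ∀ z ∈ Metric.closedBall (0 : ℂ) 1, |(G z).im| ≤ Real.pi / 2)
    {θ₀ t : ℝ} (ht : 0 < t) (ht1 : t ≤ 1) :
    ∫ θ in Set.Ioo (θ₀ - Real.pi * t) (θ₀ + Real.pi * t),
      |(G (circlePt θ)).re - (G (discPt θ₀ t)).re| ≤ 2 * Real.pi * t * oscConst := by
  have hw : discPt θ₀ t ∈ Metric.closedBall (0 : ℂ) 1 := by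
    rw [mem_closedBall_zero_iff, norm_discPt ht1]; linarith
  set w := discPt θ₀ t with hwdef
  have hπ := Real.pi_pos
  set f : ℂ → ℂ := fun z => (G z - G w) ^ 2 + ((Real.pi ^ 2 : ℝ) : ℂ) with hfdef
  have hf : DiffContOnCl ℂ f (Metric.ball 0 1) := by
    refine DiffContOnCl.add_const ?_ _
    simp only [sq]
    exact (hG.sub_const _).smul (hG.sub_const _)
  have hfc : ContinuousOn f (Metric.closedBall 0 1) := hf.continuousOn_ball
  have hGc : ContinuousOn G (Metric.closedBall 0 1) := hG.continuousOn_ball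
  have hint := integral_poissonAt_mul_re hf (θ₀ := θ₀) ht ht1
  have hfw : (f (discPt θ₀ t)).re = Real.pi ^ 2 := by
    simp [hfdef, ← hwdef, -Complex.ofReal_pow]
  rw [hfw] at hint
  have hfre : ∀ z ∈ Metric.closedBall (0 : ℂ) 1, ((G z).re - (G w).re) ^ 2 ≤ (f z).re := by
    intro z hz
    have h1 := abs_le.1 (him z hz)
    have h2 := abs_le.1 (him w hw)
    have : (f z).re = ((G z).re - (G w).re) ^ 2 - ((G z).im - (G w).im) ^ 2 + Real.pi ^ 2 := by
      simp only [hfdef, sq, Complex.add_re, Complex.mul_re, Complex.sub_re, Complex.sub_im,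
        Complex.ofReal_re]
    rw [this]
    nlinarith
  have hmem : ∀ θ, circlePt θ ∈ Metric.closedBall (0 : ℂ) 1 := fun θ => by simp [norm_circlePt]
  set g : ℝ → ℝ := fun θ => poissonAt θ₀ t θ * (f (circlePt θ)).re with hgdef
  have hgc : Continuous g := (continuous_poissonAt ht ht1).mul
    (Complex.continuous_re.comp (continuous_comp_circlePt hfc))
  have hg0 : ∀ θ, 0 ≤ g θ := fun θ =>
    mul_nonneg (poissonAt_nonneg ht ht1) ((sq_nonneg _).trans (hfre _ (hmem θ)))
  have hgper : Function.Periodic g (2 * Real.pi) := fun θ => by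
    simp only [hgdef, poissonAt, circlePt_add_two_pi]
  have hIoo : IntegrableOn g (Set.Ioc (θ₀ - Real.pi) (θ₀ - Real.pi + 2 * Real.pi)) :=
    (hgc.integrableOn_Icc).mono_set Set.Ioc_subset_Icc_self
  have hgint : ∫ θ in Set.Ioo (θ₀ - Real.pi * t) (θ₀ + Real.pi * t), g θ
      ≤ 2 * Real.pi * Real.pi ^ 2 := by
    rw [← hint, ← zero_add (2 * Real.pi), hgper.intervalIntegral_add_eq 0 (θ₀ - Real.pi),
      intervalIntegral.integral_of_le (by linarith)]
    refine setIntegral_mono_set hIoo (ae_of_all _ hg0) (LE.le.eventuallyLE ?_)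
    intro x hx
    refine ⟨?_, ?_⟩ <;> nlinarith [hx.1, hx.2]
  have hpt : ∀ θ ∈ Set.Ioo (θ₀ - Real.pi * t) (θ₀ + Real.pi * t),
      |(G (circlePt θ)).re - (G w).re| ≤ 1 / 2 + 25 * t / 2 * g θ := by
    intro θ hθ
    have h1 := one_le_mul_poissonAt (θ₀ := θ₀) (θ := θ) ht ht1
      (abs_le.2 ⟨by linarith [hθ.1], by linarith [hθ.2]⟩)
    have h2 := hfre _ (hmem θ)
    have h3 := (sq_nonneg ((G (circlePt θ)).re - (G w).re)).trans h2
    have h4 : (f (circlePt θ)).re ≤ 25 * t * g θ := by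
      have := mul_le_mul_of_nonneg_right h1 h3
      simp only [hgdef]; linarith
    have h5 : |(G (circlePt θ)).re - (G w).re| ≤ (1 + ((G (circlePt θ)).re - (G w).re) ^ 2) / 2 := by
      rw [← sq_abs]
      nlinarith [sq_nonneg (|(G (circlePt θ)).re - (G w).re| - 1)]
    linarith
  have hio : ∀ {k : ℝ → ℝ}, Continuous k →
      IntegrableOn k (Set.Ioo (θ₀ - Real.pi * t) (θ₀ + Real.pi * t)) := fun hk =>
    hk.integrableOn_Icc.mono_set Set.Ioo_subset_Icc_self
  calc _ ≤ ∫ θ in Set.Ioo (θ₀ - Real.pi * t) (θ₀ + Real.pi * t), (1 / 2 + 25 * t / 2 * g θ) := by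
        refine setIntegral_mono_on (hio ?_) (hio ?_) measurableSet_Ioo hpt
        · exact ((Complex.continuous_re.comp (continuous_comp_circlePt hGc)).sub
            continuous_const).abs
        · exact continuous_const.add (continuous_const.mul hgc)
    _ = Real.pi * t
        + 25 * t / 2 * ∫ θ in Set.Ioo (θ₀ - Real.pi * t) (θ₀ + Real.pi * t), g θ := by
        rw [integral_add (f := fun _ => 1 / 2) (g := fun θ => 25 * t / 2 * g θ)
            (hio continuous_const) (hio (continuous_const.mul hgc)),
          integral_const_mul, setIntegral_const, Real.volume_real_Ioo_of_le (by nlinarith)]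
        simp only [smul_eq_mul]; ring
    _ ≤ _ := by
        have := mul_le_mul_of_nonneg_left hgint (by positivity : 0 ≤ 25 * t / 2)
        unfold oscConst
        linarith

/-- The sum of `lⱼ (1 + conj wⱼ * z) / (1 - conj wⱼ * z)` with `wⱼ = (1 - lⱼ) e^{iθⱼ}`. Its real
part on the circle is a sum of Poisson kernels. -/
def herglotzSum (θc tl : ℕ → ℝ) (S : Finset ℕ) (z : ℂ) : ℂ :=
  ∑ j ∈ S, (tl j : ℂ) * ((1 + starRingEnd ℂ (discPt (θc j) (tl j)) * z) /
    (1 - starRingEnd ℂ (discPt (θc j) (tl j)) * z))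

lemma norm_conj_discPt_mul_lt_one {θ₀ t : ℝ} (ht : 0 < t) (ht1 : t ≤ 1) {z : ℂ}
    (hz : z ∈ Metric.closedBall (0 : ℂ) 1) : ‖starRingEnd ℂ (discPt θ₀ t) * z‖ < 1 := by
  rw [norm_mul, RCLike.norm_conj, norm_discPt ht1]
  have : ‖z‖ ≤ 1 := by simpa using hz
  nlinarith [norm_nonneg z]

lemma one_sub_ne_zero_of_norm_lt_one {u : ℂ} (hu : ‖u‖ < 1) : 1 - u ≠ 0 := by
  intro h
  rw [← sub_eq_zero.1 h, norm_one] at hu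
  exact lt_irrefl _ hu

lemma re_one_add_div_one_sub (u : ℂ) :
    ((1 + u) / (1 - u)).re = (1 - ‖u‖ ^ 2) / ‖1 - u‖ ^ 2 := by
  have h := congrFun (poissonKernel_eq_re_herglotzRieszKernel (c := 0) (w := u)) 1
  simpa [poissonKernel_def, herglotzRieszKernel_def] using h.symm

lemma re_one_add_div_one_sub_pos {u : ℂ} (hu : ‖u‖ < 1) : 0 < ((1 + u) / (1 - u)).re := by
  rw [re_one_add_div_one_sub]
  have := norm_pos_iff.2 (one_sub_ne_zero_of_norm_lt_one hu)
  have : 0 < 1 - ‖u‖ ^ 2 := by nlinarith [norm_nonneg u]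
  positivity

lemma re_term_eq_poissonAt {θ₀ t : ℝ} (ht1 : t ≤ 1) (θ : ℝ) :
    ((1 + starRingEnd ℂ (discPt θ₀ t) * circlePt θ) /
      (1 - starRingEnd ℂ (discPt θ₀ t) * circlePt θ)).re = poissonAt θ₀ t θ := by
  rw [re_one_add_div_one_sub, poissonAt_eq ht1]
  have h1 : circlePt θ * starRingEnd ℂ (circlePt θ) = 1 := by
    rw [Complex.mul_conj, Complex.normSq_eq_norm_sq, norm_circlePt]; simp
  have h2 : 1 - starRingEnd ℂ (discPt θ₀ t) * circlePt θ =
      circlePt θ * starRingEnd ℂ (circlePt θ - discPt θ₀ t) := by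
    rw [map_sub, mul_sub, h1, mul_comm (circlePt θ)]
  rw [h2, norm_mul, norm_mul, RCLike.norm_conj, RCLike.norm_conj, norm_circlePt,
    norm_discPt ht1, mul_one, one_mul]

lemma re_herglotzSum (θc tl : ℕ → ℝ) (S : Finset ℕ) (z : ℂ) :
    (herglotzSum θc tl S z).re = ∑ j ∈ S, tl j *
      ((1 + starRingEnd ℂ (discPt (θc j) (tl j)) * z) /
        (1 - starRingEnd ℂ (discPt (θc j) (tl j)) * z)).re := by
  rw [herglotzSum, Complex.re_sum]
  exact Finset.sum_congr rfl fun j _ => Complex.re_ofReal_mul _ _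

/-- A finite family of arcs of total length `s` admits a continuous function of absolutely bounded
mean oscillation and absolutely bounded integral that is at least `log (1/s) - log 25` on each
arc. -/
lemma exists_log_bump (θc tl : ℕ → ℝ) (hlen : ∀ j, 0 < tl j ∧ tl j ≤ 1) (S : Finset ℕ)
    (hS : S.Nonempty) :
    ∃ h : ℝ → ℝ, UniformContinuous h ∧ (∀ θ, h (θ + 2 * Real.pi) = h θ) ∧ (∀ θ, 0 ≤ h θ) ∧
      (∀ θ₀ t, 0 < t → t ≤ 1 → ∃ c : ℝ,
        ∫ θ in Set.Ioo (θ₀ - Real.pi * t) (θ₀ + Real.pi * t), |h θ - c|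
          ≤ 2 * Real.pi * t * oscConst) ∧
      (∫ θ in Set.Ioo 0 (2 * Real.pi), h θ ≤ 2 * Real.pi * oscConst) ∧
      ∀ j ∈ S, ∀ θ, |θ - θc j| ≤ Real.pi * tl j →
        -Real.log (∑ i ∈ S, tl i) - Real.log 25 ≤ h θ := by
  set F := herglotzSum θc tl S with hF
  set s := ∑ i ∈ S, tl i with hs
  have hspos : 0 < s := Finset.sum_pos (fun j _ => (hlen j).1) hS
  have hFpos : ∀ z ∈ Metric.closedBall (0 : ℂ) 1, 0 < (F z).re := fun z hz => by
    rw [hF, re_herglotzSum]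
    exact Finset.sum_pos (fun j _ => mul_pos (hlen j).1 (re_one_add_div_one_sub_pos
      (norm_conj_discPt_mul_lt_one (hlen j).1 (hlen j).2 hz))) hS
  have hF0 : F 0 = s := by simp [hF, herglotzSum, hs]
  have hFdiff : ∀ z ∈ Metric.closedBall (0 : ℂ) 1, DifferentiableAt ℂ F z := fun z hz => by
    simp only [hF]
    refine DifferentiableAt.fun_sum fun j _ => ?_
    refine (differentiableAt_const _).mul (DifferentiableAt.div (by fun_prop) (by fun_prop) ?_)
    exact one_sub_ne_zero_of_norm_lt_one
      (norm_conj_discPt_mul_lt_one (hlen j).1 (hlen j).2 hz)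
  set G : ℂ → ℂ := fun z => Complex.log (F z) with hGdef
  have hGdiff : ∀ z ∈ Metric.closedBall (0 : ℂ) 1, DifferentiableAt ℂ G z := fun z hz =>
    (hFdiff z hz).clog (Or.inl (hFpos z hz))
  have hGcont : ContinuousOn G (Metric.closedBall 0 1) := fun z hz =>
    (hGdiff z hz).continuousAt.continuousWithinAt
  have hG : DiffContOnCl ℂ G (Metric.ball 0 1) := by
    refine ⟨fun z hz => (hGdiff z (Metric.ball_subset_closedBall hz)).differentiableWithinAt, ?_⟩
    rwa [closure_ball _ one_ne_zero]
  have him : ∀ z ∈ Metric.closedBall (0 : ℂ) 1, |(G z).im| ≤ Real.pi / 2 := fun z hz => by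
    rw [hGdef, Complex.log_im]
    exact Complex.abs_arg_le_pi_div_two_iff.2 (hFpos z hz).le
  have hG0 : (G 0).re = Real.log s := by
    simp [hGdef, Complex.log_re, hF0, abs_of_pos hspos]
  set h : ℝ → ℝ := fun θ => |(G (circlePt θ)).re - Real.log s| with hh
  have hmaps : ∀ θ, circlePt θ ∈ Metric.sphere (0 : ℂ) 1 := fun θ => by simp [norm_circlePt]
  have hKcont : ContinuousOn (fun z => |(G z).re - Real.log s|) (Metric.sphere 0 1) :=
    ((Complex.continuous_re.comp_continuousOn
      (hGcont.mono Metric.sphere_subset_closedBall)).sub continuousOn_const).abs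
  have huc : UniformContinuous h := by
    have h1 := (isCompact_sphere (0 : ℂ) 1).uniformContinuousOn_of_continuous hKcont
    rw [Metric.uniformContinuousOn_iff] at h1
    have h2 := Metric.uniformContinuous_iff.1 uniformContinuous_circlePt
    rw [Metric.uniformContinuous_iff]
    intro ε hε
    obtain ⟨δ, hδ, h3⟩ := h1 ε hε
    obtain ⟨η, hη, h4⟩ := h2 δ hδ
    exact ⟨η, hη, fun {a b} hab => h3 _ (hmaps a) _ (hmaps b) (h4 hab)⟩
  refine ⟨h, huc, fun θ => by simp only [hh, circlePt_add_two_pi], fun θ => abs_nonneg _,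
    fun θ₀ t ht ht1 => ⟨|(G (discPt θ₀ t)).re - Real.log s|, ?_⟩, ?_, fun j hj θ hθ => ?_⟩
  · refine le_trans (setIntegral_mono ?_ ?_ fun θ => ?_) (integral_abs_re_sub_le hG him ht ht1)
    · exact ((huc.continuous.sub continuous_const).abs.integrableOn_Icc).mono_set
        Set.Ioo_subset_Icc_self
    · exact ((((Complex.continuous_re.comp (continuous_comp_circlePt hGcont)).sub
        continuous_const).abs).integrableOn_Icc).mono_set Set.Ioo_subset_Icc_self
    · refine (abs_abs_sub_abs_le _ _).trans (le_of_eq ?_)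
      ring_nf
  · have h1 := integral_abs_re_sub_le hG him (θ₀ := Real.pi) one_pos le_rfl
    have h2 : discPt Real.pi 1 = 0 := by simp [discPt]
    rw [h2, hG0] at h1
    simpa [← two_mul] using h1
  · have h1 : tl j * poissonAt (θc j) (tl j) θ ≤ (F (circlePt θ)).re := by
      rw [hF, re_herglotzSum, ← re_term_eq_poissonAt (hlen j).2]
      refine Finset.single_le_sum (f := fun j => tl j *
        ((1 + starRingEnd ℂ (discPt (θc j) (tl j)) * circlePt θ) /
        (1 - starRingEnd ℂ (discPt (θc j) (tl j)) * circlePt θ)).re) (fun i _ => ?_) hj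
      exact mul_nonneg (hlen i).1.le (re_one_add_div_one_sub_pos (norm_conj_discPt_mul_lt_one
        (hlen i).1 (hlen i).2 (by simp [norm_circlePt]))).le
    have h2 := one_le_mul_poissonAt (hlen j).1 (hlen j).2 hθ
    have h3 : (25 : ℝ)⁻¹ ≤ ‖F (circlePt θ)‖ := by
      refine le_trans ?_ (Complex.re_le_norm _)
      linarith
    have h4 : -Real.log 25 ≤ (G (circlePt θ)).re := by
      rw [hGdef, Complex.log_re, ← Real.log_inv]
      exact Real.log_le_log (by norm_num) h3
    refine le_trans ?_ (le_abs_self _)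
    linarith

section Series

variable {α E : Type*} [MeasurableSpace α] {μ : Measure α} [NormedAddCommGroup E]
  {F : ℕ → α → E}

lemma tsum_lintegral_enorm_ne_top (hF : ∀ i, Integrable (F i) μ)
    (hs : Summable fun i => ∫ a, ‖F i a‖ ∂μ) : ∑' i, ∫⁻ a, ‖F i a‖ₑ ∂μ ≠ ⊤ := by
  simp_rw [← ofReal_integral_norm_eq_lintegral_enorm (hF _)]
  exact hs.tsum_ofReal_ne_top

lemma ae_summable_norm_of_summable_integral_norm (hF : ∀ i, Integrable (F i) μ)
    (hs : Summable fun i => ∫ a, ‖F i a‖ ∂μ) : ∀ᵐ a ∂μ, Summable fun i => ‖F i a‖ := by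
  refine summable_norm_of_tsum_eLpNorm_ne_top le_rfl (fun i => (hF i).1) ?_
  simpa only [eLpNorm_one_eq_lintegral_enorm] using tsum_lintegral_enorm_ne_top hF hs

lemma integrable_tsum_of_summable_integral_norm [CompleteSpace E] (hF : ∀ i, Integrable (F i) μ)
    (hs : Summable fun i => ∫ a, ‖F i a‖ ∂μ) : Integrable (fun a => ∑' i, F i a) μ := by
  refine ⟨?_, ?_⟩
  · refine aestronglyMeasurable_of_tendsto_ae atTop
      (f := fun n a => ∑ i ∈ Finset.range n, F i a)
      (fun n => Finset.aestronglyMeasurable_fun_sum _ fun i _ => (hF i).1) ?_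
    filter_upwards [ae_summable_norm_of_summable_integral_norm hF hs] with a ha
    exact ha.of_norm.hasSum.tendsto_sum_nat
  · refine lt_of_le_of_lt (lintegral_mono fun a => enorm_tsum_le_tsum_enorm) ?_
    rw [lintegral_tsum fun i => (hF i).1.enorm]
    exact (tsum_lintegral_enorm_ne_top hF hs).lt_top

end Series

/-- The arc centered at `θ₀` of normalized length `t`, in the angle variable. -/
def arc (θ₀ t : ℝ) : Set ℝ := Set.Ioo (θ₀ - Real.pi * t) (θ₀ + Real.pi * t)

lemma volume_real_arc {θ₀ t : ℝ} (ht : 0 < t) : volume.real (arc θ₀ t) = 2 * Real.pi * t := by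
  have := Real.pi_pos
  rw [arc, Real.volume_real_Ioo_of_le (by nlinarith)]
  ring

lemma abs_sub_lt_of_mem_arc {θ₀ t θ : ℝ} (h : θ ∈ arc θ₀ t) : |θ - θ₀| < Real.pi * t :=
  abs_lt.2 ⟨by linarith [h.1], by linarith [h.2]⟩

lemma Continuous.integrableOn_arc {E : Type*} [NormedAddCommGroup E] {f : ℝ → E}
    (hf : Continuous f) (θ₀ t : ℝ) : IntegrableOn f (arc θ₀ t) :=
  hf.integrableOn_Icc.mono_set Set.Ioo_subset_Icc_self

lemma integrableOn_const_arc {E : Type*} [NormedAddCommGroup E] (c : E) (θ₀ t : ℝ) :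
    IntegrableOn (fun _ => c) (arc θ₀ t) :=
  continuous_const.integrableOn_arc θ₀ t

lemma arcAvg_eq (f : ℝ → ℂ) (θ₀ t : ℝ) :
    arcAvg f θ₀ t = ((2 * Real.pi * t)⁻¹ : ℝ) • ∫ θ in arc θ₀ t, f θ := rfl

lemma meanOsc_eq (f : ℝ → ℂ) (θ₀ t : ℝ) :
    meanOsc f θ₀ t = (2 * Real.pi * t)⁻¹ * ∫ θ in arc θ₀ t, ‖f θ - arcAvg f θ₀ t‖ := rfl

lemma meanOsc_nonneg (f : ℝ → ℂ) {θ₀ t : ℝ} (ht : 0 < t) : 0 ≤ meanOsc f θ₀ t :=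
  mul_nonneg (by have := Real.pi_pos; positivity) (integral_nonneg fun _ => norm_nonneg _)

lemma integral_norm_sub_arcAvg (f : ℝ → ℂ) {θ₀ t : ℝ} (ht : 0 < t) :
    ∫ θ in arc θ₀ t, ‖f θ - arcAvg f θ₀ t‖ = 2 * Real.pi * t * meanOsc f θ₀ t := by
  have := Real.pi_pos
  rw [meanOsc_eq, mul_inv_cancel_left₀ (by positivity)]

lemma arcAvg_const {θ₀ t : ℝ} (ht : 0 < t) (c : ℂ) : arcAvg (fun _ => c) θ₀ t = c := by
  have := Real.pi_pos
  rw [arcAvg_eq, setIntegral_const, volume_real_arc ht, smul_smul,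
    inv_mul_cancel₀ (by positivity), one_smul]

lemma meanOsc_le {f : ℝ → ℂ} {θ₀ t : ℝ} (ht : 0 < t) (hf : IntegrableOn f (arc θ₀ t)) (c : ℂ) :
    meanOsc f θ₀ t ≤ 2 * ((2 * Real.pi * t)⁻¹ * ∫ θ in arc θ₀ t, ‖f θ - c‖) := by
  have hπ := Real.pi_pos
  have hfc : IntegrableOn (fun θ => f θ - c) (arc θ₀ t) := hf.sub (integrableOn_const_arc c θ₀ t)
  have hI : 0 ≤ (2 * Real.pi * t)⁻¹ := by positivity
  have havg : ‖c - arcAvg f θ₀ t‖ ≤ (2 * Real.pi * t)⁻¹ * ∫ θ in arc θ₀ t, ‖f θ - c‖ := by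
    have h1 : arcAvg f θ₀ t - c = ((2 * Real.pi * t)⁻¹ : ℝ) • ∫ θ in arc θ₀ t, (f θ - c) := by
      rw [integral_sub hf (integrableOn_const_arc c θ₀ t), smul_sub, ← arcAvg_eq, ← arcAvg_eq,
        arcAvg_const ht]
    rw [norm_sub_rev, h1, norm_smul, Real.norm_of_nonneg hI]
    exact mul_le_mul_of_nonneg_left (norm_integral_le_integral_norm _) hI
  have h2 : ∫ θ in arc θ₀ t, ‖f θ - arcAvg f θ₀ t‖
      ≤ (∫ θ in arc θ₀ t, ‖f θ - c‖) + 2 * Real.pi * t * ‖c - arcAvg f θ₀ t‖ := by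
    rw [← volume_real_arc (θ₀ := θ₀) ht, ← smul_eq_mul, ← setIntegral_const,
      ← integral_add hfc.norm (integrableOn_const_arc _ θ₀ t)]
    refine integral_mono (hf.sub (integrableOn_const_arc _ θ₀ t)).norm
      (hfc.norm.add (integrableOn_const_arc _ θ₀ t)) fun θ => ?_
    simpa using norm_add_le (f θ - c) (c - arcAvg f θ₀ t)
  rw [meanOsc_eq]
  refine (mul_le_mul_of_nonneg_left h2 hI).trans ?_
  rw [mul_add, inv_mul_cancel_left₀ (by positivity)]
  linarith

lemma exists_meanOsc_le_of_uniformContinuous {f : ℝ → ℂ} (hf : UniformContinuous f) {ε : ℝ}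
    (hε : 0 < ε) : ∃ δ, 0 < δ ∧ ∀ θ₀ t, 0 < t → t < δ → meanOsc f θ₀ t ≤ ε := by
  have hπ := Real.pi_pos
  obtain ⟨η, hη, h⟩ := Metric.uniformContinuous_iff.1 hf (ε / 2) (by positivity)
  refine ⟨η / Real.pi, by positivity, fun θ₀ t ht htδ => ?_⟩
  refine (meanOsc_le ht (hf.continuous.integrableOn_arc θ₀ t) (f θ₀)).trans ?_
  rw [lt_div_iff₀ hπ] at htδ
  have h1 : ∫ θ in arc θ₀ t, ‖f θ - f θ₀‖ ≤ 2 * Real.pi * t * (ε / 2) := by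
    rw [← volume_real_arc (θ₀ := θ₀) ht, ← smul_eq_mul, ← setIntegral_const]
    refine setIntegral_mono_on ((hf.continuous.sub continuous_const).norm.integrableOn_arc θ₀ t)
      (integrableOn_const_arc _ θ₀ t) measurableSet_Ioo fun θ hθ => ?_
    rw [← dist_eq_norm]
    refine (h ?_).le
    rw [Real.dist_eq]
    linarith [abs_sub_lt_of_mem_arc hθ]
  have := mul_le_mul_of_nonneg_left h1 (by positivity : 0 ≤ (2 * Real.pi * t)⁻¹)
  rw [inv_mul_cancel_left₀ (by positivity)] at this
  linarith

lemma meanOsc_const_add_tsum_le {g : ℕ → ℝ → ℂ} {θ₀ t : ℝ} (ht : 0 < t)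
    (hg : ∀ k, IntegrableOn (g k) (arc θ₀ t))
    (hs : Summable fun k => ∫ θ in arc θ₀ t, ‖g k θ‖)
    (ho : Summable fun k => meanOsc (g k) θ₀ t) (c : ℂ) :
    meanOsc (fun θ => c + ∑' k, g k θ) θ₀ t ≤ ∑' k, meanOsc (g k) θ₀ t := by
  have hπ := Real.pi_pos
  have hI : 0 ≤ (2 * Real.pi * t)⁻¹ := by positivity
  have hsum : HasSum (fun k => arcAvg (g k) θ₀ t)
      (arcAvg (fun θ => ∑' k, g k θ) θ₀ t) :=
    (hasSum_integral_of_summable_integral_norm hg hs).const_smul _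
  have havg : arcAvg (fun θ => c + ∑' k, g k θ) θ₀ t = c + ∑' k, arcAvg (g k) θ₀ t := by
    rw [hsum.tsum_eq, arcAvg_eq, integral_add (integrableOn_const_arc c θ₀ t)
      (integrable_tsum_of_summable_integral_norm hg hs), smul_add, ← arcAvg_eq, ← arcAvg_eq,
      arcAvg_const ht]
  set d : ℕ → ℝ → ℝ := fun k θ => ‖g k θ - arcAvg (g k) θ₀ t‖ with hd
  have hdi : ∀ k, IntegrableOn (d k) (arc θ₀ t) := fun k =>
    ((hg k).sub (integrableOn_const_arc _ θ₀ t)).norm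
  have hdn : ∀ k, ∫ θ in arc θ₀ t, ‖d k θ‖ = 2 * Real.pi * t * meanOsc (g k) θ₀ t := fun k => by
    simp only [hd, norm_norm]
    exact integral_norm_sub_arcAvg (g k) ht
  have hds : Summable fun k => ∫ θ in arc θ₀ t, ‖d k θ‖ := by
    simp only [hdn]
    exact ho.mul_left _
  have h1 : ∫ θ in arc θ₀ t, ‖(c + ∑' k, g k θ) - arcAvg (fun θ => c + ∑' k, g k θ) θ₀ t‖
      ≤ ∫ θ in arc θ₀ t, ∑' k, d k θ := by
    refine integral_mono_of_nonneg (ae_of_all _ fun _ => norm_nonneg _)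
      (integrable_tsum_of_summable_integral_norm hdi hds) ?_
    filter_upwards [ae_summable_norm_of_summable_integral_norm hg hs,
      ae_summable_norm_of_summable_integral_norm hdi hds] with θ h2 h3
    simp only [hd, norm_norm] at h3
    rw [havg, add_sub_add_left_eq_sub, ← h2.of_norm.tsum_sub hsum.summable]
    exact norm_tsum_le_tsum_norm h3
  have h4 : ∫ θ in arc θ₀ t, ∑' k, d k θ = 2 * Real.pi * t * ∑' k, meanOsc (g k) θ₀ t := by
    rw [← integral_tsum_of_summable_integral_norm hdi hds, ← tsum_mul_left]
    exact tsum_congr fun k => integral_norm_sub_arcAvg (g k) ht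
  rw [meanOsc_eq]
  refine (mul_le_mul_of_nonneg_left (h1.trans h4.le) hI).trans ?_
  rw [inv_mul_cancel_left₀ (by positivity)]

lemma setIntegral_arc_le_of_periodic {h : ℝ → ℝ} (hc : Continuous h)
    (hper : Function.Periodic h (2 * Real.pi)) (h0 : ∀ θ, 0 ≤ h θ) {θ₀ t : ℝ} (ht1 : t ≤ 1) :
    ∫ θ in arc θ₀ t, h θ ≤ ∫ θ in Set.Ioo 0 (2 * Real.pi), h θ := by
  have hπ := Real.pi_pos
  rw [← integral_Ioc_eq_integral_Ioo, ← intervalIntegral.integral_of_le (by linarith),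
    ← zero_add (2 * Real.pi), hper.intervalIntegral_add_eq 0 (θ₀ - Real.pi),
    intervalIntegral.integral_of_le (by linarith)]
  refine setIntegral_mono_set (hc.integrableOn_Icc.mono_set Set.Ioc_subset_Icc_self)
    (ae_of_all _ h0) (LE.le.eventuallyLE ?_)
  intro x hx
  refine ⟨?_, ?_⟩ <;> nlinarith [hx.1, hx.2]

/-- A sequence of indices beyond which the sums of a summable sequence are prescribedly small. -/
lemma exists_strictMono_sum_le {u : ℕ → ℝ} (hu : Summable u) {b : ℕ → ℝ} (hb : ∀ k, 0 < b k) :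
    ∃ N : ℕ → ℕ, StrictMono N ∧
      ∀ k, ∀ S : Finset ℕ, (∀ i ∈ S, N k ≤ i) → ∑ i ∈ S, u i ≤ b k := by
  refine extraction_forall_of_eventually (P := fun k n =>
    ∀ S : Finset ℕ, (∀ i ∈ S, n ≤ i) → ∑ i ∈ S, u i ≤ b k) fun k => ?_
  obtain ⟨s, hs⟩ := summable_iff_vanishing_norm.1 hu (b k) (hb k)
  filter_upwards [eventually_gt_atTop (s.sup id)] with n hn S hS
  refine (le_abs_self _).trans (hs S (Finset.disjoint_left.2 fun i hi his => ?_)).le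
  exact absurd (Finset.le_sup (f := id) his) (not_le.2 (hn.trans_le (hS i hi)))

lemma StrictMono.exists_mem_Ico {N : ℕ → ℕ} (hN : StrictMono N) {K j : ℕ} (hj : N K ≤ j) :
    ∃ k, K ≤ k ∧ j ∈ Finset.Ico (N k) (N (k + 1)) := by
  have hK : K ≤ j := hN.le_apply.trans hj
  refine ⟨Nat.findGreatest (fun k => N k ≤ j) j, Nat.le_findGreatest hK hj,
    Finset.mem_Ico.2 ⟨Nat.findGreatest_spec (P := fun k => N k ≤ j) hK hj, ?_⟩⟩
  by_contra! h
  have := Nat.le_findGreatest (P := fun k => N k ≤ j) (hN.le_apply.trans h) h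
  omega

/-- Corollary 2.3: given arcs `I_j` (centered at `e^{iθc j}` of normalized length
`tl j`) with `Σ_j |I_j| < ∞`, there is a positive function `f ∈ VMO` whose averages
over `I_j` tend to `+∞`. -/
theorem stmt_7 (θc tl : ℕ → ℝ) (hlen : ∀ j, 0 < tl j ∧ tl j ≤ 1)
    (hsum : Summable tl) :
    ∃ f : ℝ → ℝ, (∀ θ : ℝ, 0 < f θ) ∧ IsVMO (fun θ => ((f θ : ℝ) : ℂ)) ∧
      Tendsto (fun j : ℕ => (2 * Real.pi * tl j)⁻¹ *
          ∫ θ in Set.Ioo (θc j - Real.pi * tl j) (θc j + Real.pi * tl j), f θ)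
        atTop atTop := by
  have hπ := Real.pi_pos
  obtain ⟨N, hN, hNs⟩ := exists_strictMono_sum_le hsum (b := fun k => Real.exp (-4 ^ k))
    fun k => Real.exp_pos _
  have hne : ∀ k, (Finset.Ico (N k) (N (k + 1))).Nonempty := fun k =>
    Finset.nonempty_Ico.2 (hN k.lt_succ_self)
  choose h huc hper h0 hosc hint hlog using fun k =>
    exists_log_bump θc tl hlen (Finset.Ico (N k) (N (k + 1))) (hne k)
  set g : ℕ → ℝ → ℝ := fun k θ => (1 / 2) ^ k * h k θ with hg
  set γ : ℕ → ℝ → ℂ := fun k θ => ((g k θ : ℝ) : ℂ) with hγ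
  have hguc : ∀ k, UniformContinuous (g k) := fun k => (huc k).const_mul' _
  have hγuc : ∀ k, UniformContinuous (γ k) := fun k =>
    Complex.isometry_ofReal.uniformContinuous.comp (hguc k)
  have hg0 : ∀ k θ, 0 ≤ g k θ := fun k θ => mul_nonneg (by positivity) (h0 k θ)
  have hgi : ∀ θ₀ t k, IntegrableOn (g k) (arc θ₀ t) := fun θ₀ t k =>
    (hguc k).continuous.integrableOn_arc θ₀ t
  have hγi : ∀ θ₀ t k, IntegrableOn (γ k) (arc θ₀ t) := fun θ₀ t k =>
    (hγuc k).continuous.integrableOn_arc θ₀ t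
  have hgeom : Summable fun k : ℕ => ((1 : ℝ) / 2) ^ k := summable_geometric_two
  have hgs : ∀ θ₀ t, t ≤ 1 → Summable fun k => ∫ θ in arc θ₀ t, ‖g k θ‖ := by
    intro θ₀ t ht1
    refine (hgeom.mul_right (2 * Real.pi * oscConst)).of_nonneg_of_le
      (fun k => integral_nonneg fun _ => norm_nonneg _) fun k => ?_
    simp only [Real.norm_of_nonneg (hg0 k _)]
    rw [integral_const_mul]
    exact mul_le_mul_of_nonneg_left ((setIntegral_arc_le_of_periodic (huc k).continuous (hper k)
      (h0 k) ht1).trans (hint k)) (by positivity)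
  have hγs : ∀ θ₀ t, t ≤ 1 → Summable fun k => ∫ θ in arc θ₀ t, ‖γ k θ‖ := by
    simpa only [hγ, Complex.norm_real] using hgs
  have hγo : ∀ θ₀ t, 0 < t → t ≤ 1 → ∀ k, meanOsc (γ k) θ₀ t ≤ (1 / 2) ^ k * (2 * oscConst) := by
    intro θ₀ t ht ht1 k
    obtain ⟨c, hc⟩ := hosc k θ₀ t ht ht1
    refine (meanOsc_le ht (hγi θ₀ t k) (((1 / 2) ^ k * c : ℝ) : ℂ)).trans ?_
    have h1 : ∫ θ in arc θ₀ t, ‖γ k θ - (((1 / 2) ^ k * c : ℝ) : ℂ)‖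
        = (1 / 2) ^ k * ∫ θ in arc θ₀ t, |h k θ - c| := by
      rw [← integral_const_mul]
      refine integral_congr_ae (ae_of_all _ fun θ => ?_)
      simp only [hγ, hg]
      rw [← Complex.ofReal_sub, Complex.norm_real, ← mul_sub, Real.norm_eq_abs, abs_mul,
        abs_of_nonneg (by positivity : (0 : ℝ) ≤ (1 / 2) ^ k)]
    rw [h1]
    have h2 := mul_le_mul_of_nonneg_left hc (by positivity : 0 ≤ (2 * Real.pi * t)⁻¹)
    rw [inv_mul_cancel_left₀ (by positivity)] at h2
    have h3 := mul_le_mul_of_nonneg_left h2 (by positivity : (0 : ℝ) ≤ (1 / 2) ^ k)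
    simp only [arc] at h3 ⊢
    linarith
  have hγos : ∀ θ₀ t, 0 < t → t ≤ 1 → Summable fun k => meanOsc (γ k) θ₀ t :=
    fun θ₀ t ht ht1 => (hgeom.mul_right (2 * oscConst)).of_nonneg_of_le
      (fun k => meanOsc_nonneg _ ht) (hγo θ₀ t ht ht1)
  have hcast : (fun θ => ((1 + ∑' k, g k θ : ℝ) : ℂ)) = fun θ => 1 + ∑' k, γ k θ := by
    funext θ
    rw [Complex.ofReal_add, Complex.ofReal_tsum, Complex.ofReal_one]
  have hfo : ∀ θ₀ t, 0 < t → t ≤ 1 →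
      meanOsc (fun θ => ((1 + ∑' k, g k θ : ℝ) : ℂ)) θ₀ t ≤ ∑' k, meanOsc (γ k) θ₀ t := by
    intro θ₀ t ht ht1
    rw [hcast]
    exact meanOsc_const_add_tsum_le ht (hγi θ₀ t) (hγs θ₀ t ht1) (hγos θ₀ t ht ht1) 1
  refine ⟨fun θ => 1 + ∑' k, g k θ, fun θ => ?_, ⟨⟨fun θ => ?_, ?_, ?_⟩, ?_⟩, ?_⟩
  · exact add_pos_of_pos_of_nonneg one_pos (tsum_nonneg fun k => hg0 k θ)
  · simp only [hg, hper]
  · rw [hcast, integrableOn_Ioc_iff_integrableOn_Ioo]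
    have h1 : arc Real.pi 1 = Set.Ioo 0 (2 * Real.pi) := by
      rw [arc]; congr 1 <;> ring
    rw [← h1]
    exact (integrableOn_const_arc 1 _ _).add
      (integrable_tsum_of_summable_integral_norm (hγi _ _) (hγs _ _ le_rfl))
  · refine ⟨∑' k : ℕ, (1 / 2 : ℝ) ^ k * (2 * oscConst), fun θ₀ t ht ht1 =>
      (hfo θ₀ t ht ht1).trans ?_⟩
    exact (hγos θ₀ t ht ht1).tsum_le_tsum (hγo θ₀ t ht ht1) (hgeom.mul_right _)
  · intro ε hε
    have hev : ∀ {P : ℝ × ℝ → Prop}, (∀ᶠ p in comap Prod.snd (𝓝[>] (0 : ℝ)), P p) ↔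
        ∃ δ, 0 < δ ∧ ∀ θ₀ t, 0 < t → t < δ → P (θ₀, t) := by
      intro P
      rw [((nhdsGT_basis (0 : ℝ)).comap Prod.snd).eventually_iff]
      simp only [Set.mem_preimage, Set.mem_Ioo, Prod.forall, and_imp]
    have hlim : Tendsto (fun p : ℝ × ℝ => ∑' k, meanOsc (γ k) p.1 p.2)
        (comap Prod.snd (𝓝[>] (0 : ℝ))) (𝓝 (∑' _ : ℕ, 0)) := by
      refine tendsto_tsum_of_dominated_convergence (hgeom.mul_right (2 * oscConst)) (fun k => ?_) ?_
      · rw [Metric.tendsto_nhds]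
        intro η hη
        obtain ⟨δ, hδ, hδ'⟩ := exists_meanOsc_le_of_uniformContinuous (hγuc k) (half_pos hη)
        refine hev.2 ⟨δ, hδ, fun θ₀ t ht htδ => ?_⟩
        rw [Real.dist_eq, sub_zero, abs_of_nonneg (meanOsc_nonneg _ ht)]
        linarith [hδ' θ₀ t ht htδ]
      · refine hev.2 ⟨1, one_pos, fun θ₀ t ht ht1 k => ?_⟩
        rw [Real.norm_of_nonneg (meanOsc_nonneg _ ht)]
        exact hγo θ₀ t ht ht1.le k
    rw [tsum_zero] at hlim
    obtain ⟨δ, hδ, hδ'⟩ := hev.1 (hlim.eventually (eventually_le_nhds hε))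
    exact ⟨min δ 1, lt_min hδ one_pos, fun θ₀ t ht htδ =>
      (hfo θ₀ t ht (htδ.le.trans (min_le_right _ _))).trans
        (hδ' θ₀ t ht (htδ.trans_le (min_le_left _ _)))⟩
  · have key : ∀ k, ∀ j ∈ Finset.Ico (N k) (N (k + 1)), (2 : ℝ) ^ k - Real.log 25 ≤
        (2 * Real.pi * tl j)⁻¹ * ∫ θ in arc (θc j) (tl j), (1 + ∑' k, g k θ) := by
      intro k j hj
      obtain ⟨ht, ht1⟩ := hlen j
      have hlog25 : 0 ≤ Real.log 25 := Real.log_nonneg (by norm_num)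
      have hspos : 0 < ∑ i ∈ Finset.Ico (N k) (N (k + 1)), tl i :=
        Finset.sum_pos (fun i _ => (hlen i).1) (hne k)
      have hs : (4 : ℝ) ^ k ≤ -Real.log (∑ i ∈ Finset.Ico (N k) (N (k + 1)), tl i) := by
        have := Real.log_le_log hspos (hNs k _ fun i hi => (Finset.mem_Ico.1 hi).1)
        rw [Real.log_exp] at this
        linarith
      have hgk : ∀ θ ∈ arc (θc j) (tl j), (2 : ℝ) ^ k - Real.log 25 ≤ g k θ := by
        intro θ hθ
        have h1 := hlog k j hj θ (abs_sub_lt_of_mem_arc hθ).le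
        have h2 : (4 : ℝ) ^ k - Real.log 25 ≤ h k θ := by linarith
        have h3 := mul_le_mul_of_nonneg_left h2 (by positivity : (0 : ℝ) ≤ (1 / 2) ^ k)
        have h4 : ((1 : ℝ) / 2) ^ k * 4 ^ k = 2 ^ k := by rw [← mul_pow]; norm_num
        have h5 : ((1 : ℝ) / 2) ^ k ≤ 1 := pow_le_one₀ (by norm_num) (by norm_num)
        simp only [hg]
        nlinarith
      have hle : 2 * Real.pi * tl j * ((2 : ℝ) ^ k - Real.log 25) ≤
          ∫ θ in arc (θc j) (tl j), (1 + ∑' k, g k θ) := by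
        rw [← volume_real_arc (θ₀ := θc j) ht, ← smul_eq_mul, ← setIntegral_const]
        refine integral_mono_ae (integrableOn_const_arc _ _ _)
          ((integrableOn_const_arc 1 _ _).add (integrable_tsum_of_summable_integral_norm
            (hgi _ _) (hgs _ _ ht1))) ?_
        filter_upwards [ae_summable_norm_of_summable_integral_norm (hgi _ _) (hgs _ _ ht1),
          ae_restrict_mem measurableSet_Ioo] with θ h1 h2
        have h3 := h1.of_norm.le_tsum k fun i _ => hg0 i θ
        have h4 := hgk θ h2
        linarith
      rwa [le_inv_mul_iff₀ (by positivity)]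
    refine tendsto_atTop.2 fun M => ?_
    obtain ⟨K, hK⟩ := pow_unbounded_of_one_lt (M + Real.log 25) (one_lt_two (α := ℝ))
    filter_upwards [eventually_ge_atTop (N K)] with j hj
    obtain ⟨k, hk, hjk⟩ := hN.exists_mem_Ico hj
    refine le_trans ?_ (key k j hjk)
    have := pow_le_pow_right₀ (one_le_two (α := ℝ)) hk
    linarith
end
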